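/- Let P ⊆ ℝ² be the convex hull of the six points (cos(πk/3), sin(πk/3)) for k = 0,1,2,3,4,5 (a regular hexagon). Then every convex pentagon Q with P ⊆ Q satisfies |Q| ≥ (7/6)·|P|. -/

import Mathlib

open MeasureTheory Real

/-- A convex `n`-gon in the plane: the convex hull of a finite set of at most `n` points,
having nonempty interior. -/
def IsConvexPolygon (n : ℕ) (Q : Set (ℝ × ℝ)) : Prop :=
  ∃ S : Finset (ℝ × ℝ), S.card ≤ n ∧ Q = convexHull ℝ (S : Set (ℝ × ℝ)) ∧
    (interior Q).Nonempty

/-- The linear map sending the standard basis of the plane to `u`, `v`. -/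
def planeMap (u v : ℝ × ℝ) : ℝ × ℝ →ₗ[ℝ] ℝ × ℝ :=
  (LinearMap.fst ℝ ℝ ℝ).smulRight u + (LinearMap.snd ℝ ℝ ℝ).smulRight v

theorem planeMap_apply (u v p : ℝ × ℝ) : planeMap u v p = p.1 • u + p.2 • v := rfl

theorem det_planeMap (u v : ℝ × ℝ) :
    LinearMap.det (planeMap u v) = u.1 * v.2 - u.2 * v.1 := by
  rw [← LinearMap.det_toMatrix (Module.Basis.finTwoProd ℝ), Matrix.det_fin_two]
  simp [LinearMap.toMatrix_apply, planeMap_apply]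
  ring

/-- The standard open triangle, with vertices `(0, 0)`, `(1, 0)` and `(0, 1)`. -/
def stdTriangle : Set (ℝ × ℝ) := {p | 0 < p.1 ∧ 0 < p.2 ∧ p.1 + p.2 < 1}

theorem convex_stdTriangle : Convex ℝ stdTriangle := by
  rintro ⟨a, b⟩ ⟨h1, h2, h3⟩ ⟨c, d⟩ ⟨h4, h5, h6⟩ s t hs ht hst
  simp only at h1 h2 h3 h4 h5 h6
  obtain rfl : t = 1 - s := by linarith
  rcases hs.eq_or_lt with rfl | hs
  · simp_all [stdTriangle]
  · refine ⟨?_, ?_, ?_⟩ <;> simp <;> nlinarith [mul_pos hs h1, mul_pos hs h2]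

theorem volume_stdTriangle : volume stdTriangle = ENNReal.ofReal (1 / 2) := by
  have h : stdTriangle = regionBetween (fun _ => 0) (fun x => 1 - x) (Set.Ioo (0 : ℝ) 1) := by
    ext ⟨x, y⟩
    simp only [stdTriangle, regionBetween, Set.mem_ofPred_eq, Set.mem_Ioo]
    constructor
    · rintro ⟨h1, h2, h3⟩
      exact ⟨⟨h1, by linarith⟩, h2, by linarith⟩
    · rintro ⟨⟨h1, h2⟩, h3, h4⟩
      exact ⟨h1, h3, by linarith⟩
  have hint : IntegrableOn (fun x : ℝ => 1 - x) (Set.Ioo 0 1) :=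
    (Continuous.integrableOn_Icc (by fun_prop)).mono_set Set.Ioo_subset_Icc_self
  rw [h, Measure.volume_eq_prod, volume_regionBetween_eq_integral integrableOn_zero hint
    measurableSet_Ioo fun x hx => by simpa using hx.2.le]
  congr 1
  rw [← integral_Ioc_eq_integral_Ioo, ← intervalIntegral.integral_of_le zero_le_one]
  simp only [Pi.sub_apply, sub_zero]
  rw [intervalIntegral.integral_sub (by simp) (by simp)]
  norm_num

/-- The open triangle with vertices `a`, `b` and `c`. -/
def openTriangle (a b c : ℝ × ℝ) : Set (ℝ × ℝ) :=
  (fun p => a + p) '' (planeMap (b - a) (c - a) '' stdTriangle)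

theorem convex_openTriangle (a b c : ℝ × ℝ) : Convex ℝ (openTriangle a b c) :=
  (convex_stdTriangle.linear_image _).translate a

theorem volume_openTriangle (a b c : ℝ × ℝ) :
    volume (openTriangle a b c) =
      ENNReal.ofReal (|(b - a).1 * (c - a).2 - (b - a).2 * (c - a).1| / 2) := by
  rw [openTriangle, Set.image_add_left, measure_preimage_add, Measure.addHaar_image_linearMap,
    det_planeMap, volume_stdTriangle, ← ENNReal.ofReal_mul (abs_nonneg _)]
  congr 1
  ring

theorem exists_weights_of_mem_openTriangle {a b c p : ℝ × ℝ} (hp : p ∈ openTriangle a b c) :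
    ∃ x y z : ℝ, 0 < x ∧ 0 < y ∧ 0 < z ∧ x + y + z = 1 ∧ p = x • a + y • b + z • c := by
  obtain ⟨_, ⟨q, ⟨h1, h2, h3⟩, rfl⟩, rfl⟩ := hp
  refine ⟨1 - q.1 - q.2, q.1, q.2, by linarith, h1, h2, by ring, ?_⟩
  simp only [planeMap_apply]
  module

theorem openTriangle_subset {Q : Set (ℝ × ℝ)} (hQ : Convex ℝ Q) {a b c : ℝ × ℝ} (ha : a ∈ Q)
    (hb : b ∈ Q) (hc : c ∈ Q) : openTriangle a b c ⊆ Q := by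
  intro p hp
  obtain ⟨x, y, z, hx, hy, hz, hxyz, rfl⟩ := exists_weights_of_mem_openTriangle hp
  have h := hQ.sum_mem (t := Finset.univ) (w := ![x, y, z]) (z := ![a, b, c])
    (by simp [Fin.forall_fin_succ, hx.le, hy.le, hz.le]) (by simpa [Fin.sum_univ_three] using hxyz)
    (by simp [Fin.forall_fin_succ, ha, hb, hc])
  simpa [Fin.sum_univ_three] using h

/-- The affine functionals whose nonpositivity cuts out the affinely regular hexagon with
vertices `hexVertex k`. -/
def hexExcess (k : Fin 6) (p : ℝ × ℝ) : ℝ :=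
  ![p.1 - 1, p.2 - 1, p.2 - p.1 - 1, -p.1 - 1, -p.2 - 1, p.1 - p.2 - 1] k

/-- The vertices of an affinely regular hexagon. -/
def hexVertex (k : Fin 6) : ℝ × ℝ :=
  ![(1, 0), (1, 1), (0, 1), (-1, 0), (-1, -1), (0, -1)] k

theorem hexExcess_sub_one_add (k : Fin 6) (p : ℝ × ℝ) :
    hexExcess (k - 1) p + hexExcess (k + 1) p = hexExcess k p - 1 := by
  fin_cases k <;> simp [hexExcess] <;> ring

theorem hexExcess_add_opposite (k : Fin 6) (p : ℝ × ℝ) :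
    hexExcess k p + hexExcess (k + 3) p = -2 := by
  fin_cases k <;> simp [hexExcess] <;> ring

theorem hexExcess_combo (k : Fin 6) (a b c : ℝ × ℝ) {x y z : ℝ} (h : x + y + z = 1) :
    hexExcess k (x • a + y • b + z • c) =
      x * hexExcess k a + y * hexExcess k b + z * hexExcess k c := by
  obtain rfl : x = 1 - y - z := by linarith
  fin_cases k <;> simp [hexExcess] <;> ring

theorem hexExcess_hexVertex (k : Fin 6) : hexExcess k (hexVertex k) = 0 := by
  fin_cases k <;> simp [hexExcess, hexVertex]

theorem hexExcess_hexVertex_add_one (k : Fin 6) : hexExcess k (hexVertex (k + 1)) = 0 := by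
  fin_cases k <;> simp [hexExcess, hexVertex]

theorem hexExcess_add_one_hexVertex (k : Fin 6) : hexExcess (k + 1) (hexVertex k) = -1 := by
  fin_cases k <;> simp [hexExcess, hexVertex]

theorem hexExcess_hexVertex_add_two (k : Fin 6) :
    hexExcess k (hexVertex (k + 1 + 1)) = -1 := by
  fin_cases k <;> simp [hexExcess, hexVertex]

theorem hexExcess_hexVertex_nonpos (k j : Fin 6) : hexExcess k (hexVertex j) ≤ 0 := by
  fin_cases k <;> fin_cases j <;> simp [hexExcess, hexVertex]

theorem convexOn_hexExcess (k : Fin 6) : ConvexOn ℝ Set.univ (hexExcess k) := by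
  refine ⟨convex_univ, fun p _ q _ a b _ _ hab => le_of_eq ?_⟩
  obtain rfl : b = 1 - a := by linarith
  fin_cases k <;> simp [hexExcess] <;> ring

theorem volume_openTriangle_hexVertex (k : Fin 6) (q : ℝ × ℝ) :
    volume (openTriangle (hexVertex k) (hexVertex (k + 1)) q) =
      ENNReal.ofReal (|hexExcess k q| / 2) := by
  rw [volume_openTriangle, ← abs_neg (hexExcess k q)]
  congr 3
  fin_cases k <;> simp [hexExcess, hexVertex] <;> ring

theorem fin_six_cases_of_ne : ∀ {i j : Fin 6}, i ≠ j →
    j = i + 1 ∨ i = j + 1 ∨ j = i + 2 ∨ i = j + 2 ∨ j = i + 3 := by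
  decide

/-- If the hexagon is contained in the convex hull of at most five points, one of these points
lies far beyond an edge. -/
theorem exists_le_hexExcess {S : Finset (ℝ × ℝ)} (hS : S.card ≤ 5)
    (hH : ∀ k, hexVertex k ∈ convexHull ℝ (S : Set (ℝ × ℝ))) {d : Fin 6 → ℝ}
    (hd : ∀ k, 0 < d k) (hsum : ∑ k, d k ≤ 1) : ∃ k, ∃ s ∈ S, d k ≤ hexExcess k s := by
  by_contra! hlt
  have hcap : ∀ k, ∃ s ∈ S,
      0 ≤ d (k + 1) * hexExcess k s + d k * hexExcess (k + 1) s := by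
    intro k
    have hconv : ConvexOn ℝ Set.univ
        fun p => d (k + 1) * hexExcess k p + d k * hexExcess (k + 1) p :=
      ((convexOn_hexExcess k).smul (hd (k + 1)).le).add
        ((convexOn_hexExcess (k + 1)).smul (hd k).le)
    obtain ⟨s, hs, h⟩ := hconv.exists_ge_of_mem_convexHull (Set.subset_univ _) (hH (k + 1))
    refine ⟨s, hs, ?_⟩
    simpa [hexExcess_hexVertex, hexExcess_hexVertex_add_one] using h
  choose s hsS hs using hcap
  obtain ⟨i, -, j, -, hij, hsij⟩ := Finset.exists_ne_map_eq_of_card_lt_of_maps_to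
    (s := Finset.univ) (t := S) (by simp; omega) fun k _ => hsS k
  have hd1 : ∀ k, d k ≤ 1 := fun k =>
    (Finset.single_le_sum (fun j _ => (hd j).le) (Finset.mem_univ k)).trans hsum
  have hd3 : ∀ k, d k + d (k + 1) + d (k + 1 + 1) ≤ 1 := by
    intro k
    have h0 := hd 0
    have h1 := hd 1
    have h2 := hd 2
    have h3 := hd 3
    have h4 := hd 4
    have h5 := hd 5
    rw [Fin.sum_univ_six] at hsum
    fin_cases k <;> simp <;> linarith
  have hfst : ∀ k, -1 < hexExcess k (s k) := fun k => by
    by_contra! h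
    nlinarith [hs k, hlt (k + 1) (s k) (hsS k), hd k, hd (k + 1), hd1 k,
      mul_lt_mul_of_pos_left (hlt (k + 1) (s k) (hsS k)) (hd k)]
  have hsnd : ∀ k, -1 < hexExcess (k + 1) (s k) := fun k => by
    by_contra! h
    nlinarith [hs k, hlt k (s k) (hsS k), hd k, hd (k + 1), hd1 (k + 1),
      mul_lt_mul_of_pos_left (hlt k (s k) (hsS k)) (hd (k + 1))]
  have hadj : ∀ k, s k ≠ s (k + 1) := by
    intro k h
    have h1 := hs k
    have h2 := hs (k + 1)
    rw [← h] at h2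
    have h3 := hlt (k + 1) (s k) (hsS k)
    have h4 := hexExcess_sub_one_add (k + 1) (s k)
    rw [add_sub_cancel_right] at h4
    nlinarith [hd3 k, hd k, hd (k + 1), hd (k + 1 + 1)]
  have htwo : ∀ k, s k ≠ s (k + 2) := by
    intro k h
    have h1 := hfst k
    have h2 := hsnd (k + 2)
    rw [← h, show k + 2 + 1 = k + 3 from add_assoc k 2 1] at h2
    linarith [hexExcess_add_opposite k (s k)]
  have hthree : ∀ k, s k ≠ s (k + 3) := by
    intro k h
    have h2 := hfst (k + 3)
    rw [← h] at h2
    linarith [hfst k, hexExcess_add_opposite k (s k)]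
  rcases fin_six_cases_of_ne hij with rfl | rfl | rfl | rfl | rfl
  · exact hadj _ hsij
  · exact hadj _ hsij.symm
  · exact htwo _ hsij
  · exact htwo _ hsij.symm
  · exact hthree _ hsij

/-- The affinely regular hexagon with vertices `hexVertex k`. -/
def latticeHexagon : Set (ℝ × ℝ) := convexHull ℝ (Set.range hexVertex)

theorem hexExcess_nonpos {p : ℝ × ℝ} (hp : p ∈ latticeHexagon) (k : Fin 6) :
    hexExcess k p ≤ 0 := by
  obtain ⟨_, ⟨j, rfl⟩, h⟩ :=
    (convexOn_hexExcess k).exists_ge_of_mem_convexHull (Set.subset_univ _) hp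
  exact h.trans (hexExcess_hexVertex_nonpos k j)

theorem volume_planeMap_image_unitSquare (u v : ℝ × ℝ) :
    volume (planeMap u v '' (Set.Icc 0 1 ×ˢ Set.Icc 0 1)) =
      ENNReal.ofReal |u.1 * v.2 - u.2 * v.1| := by
  rw [Measure.addHaar_image_linearMap, det_planeMap, Measure.volume_eq_prod, Measure.prod_prod]
  simp

theorem volume_latticeHexagon_le : volume latticeHexagon ≤ 3 := by
  have hsub : latticeHexagon ⊆ planeMap (1, 0) (0, 1) '' (Set.Icc 0 1 ×ˢ Set.Icc 0 1) ∪
      (planeMap (0, 1) (-1, -1) '' (Set.Icc 0 1 ×ˢ Set.Icc 0 1) ∪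
        planeMap (-1, -1) (1, 0) '' (Set.Icc 0 1 ×ˢ Set.Icc 0 1)) := by
    intro p hp
    have h0 := hexExcess_nonpos hp 0
    have h1 := hexExcess_nonpos hp 1
    have h2 := hexExcess_nonpos hp 2
    have h3 := hexExcess_nonpos hp 3
    have h4 := hexExcess_nonpos hp 4
    have h5 := hexExcess_nonpos hp 5
    simp [hexExcess] at h0 h1 h2 h3 h4 h5
    by_cases hpos : 0 ≤ p.1 ∧ 0 ≤ p.2
    · refine Or.inl ⟨(p.1, p.2), ⟨⟨hpos.1, by simpa using h0⟩, hpos.2, by simpa using h1⟩, ?_⟩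
      ext <;> simp [planeMap_apply]
    by_cases hneg : p.1 ≤ 0 ∧ p.1 ≤ p.2
    · refine Or.inr (Or.inl ⟨(p.2 - p.1, -p.1), ⟨⟨?_, ?_⟩, ?_, ?_⟩, ?_⟩)
      on_goal 5 => ext <;> simp [planeMap_apply]
      all_goals simp only; linarith [hneg.1, hneg.2]
    · have hle : p.2 ≤ 0 ∧ p.2 ≤ p.1 := by
        rcases le_total p.1 0 with h | h
        · have := not_le.1 fun h' => hneg ⟨h, h'⟩
          exact ⟨by linarith, this.le⟩
        · have := not_le.1 fun h' => hpos ⟨h, h'⟩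
          exact ⟨this.le, by linarith⟩
      refine Or.inr (Or.inr ⟨(-p.2, p.1 - p.2), ⟨⟨?_, ?_⟩, ?_, ?_⟩, ?_⟩)
      on_goal 5 => ext <;> simp [planeMap_apply]
      all_goals simp only; linarith [hle.1, hle.2]
  refine (measure_mono hsub).trans ((measure_union_le _ _).trans
    ((add_le_add_right (measure_union_le _ _) _).trans ?_))
  simp only [volume_planeMap_image_unitSquare]
  norm_num

theorem volume_latticeHexagon_add_sum_le {Q : Set (ℝ × ℝ)} (hQ : Convex ℝ Q)
    (hH : ∀ k, hexVertex k ∈ Q) {q : Fin 6 → ℝ × ℝ} (hq : ∀ k, q k ∈ Q) {F : Finset (Fin 6)}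
    (hpos : ∀ k ∈ F, 0 < hexExcess k (q k))
    (hdisj : (F : Set (Fin 6)).PairwiseDisjoint
      fun k => openTriangle (hexVertex k) (hexVertex (k + 1)) (q k)) :
    volume latticeHexagon + ENNReal.ofReal (∑ k ∈ F, hexExcess k (q k) / 2) ≤ volume Q := by
  set T : Fin 6 → Set (ℝ × ℝ) :=
    fun k => openTriangle (hexVertex k) (hexVertex (k + 1)) (q k) with hT
  have hTm : ∀ k ∈ F, NullMeasurableSet (T k) volume := fun k _ =>
    (convex_openTriangle _ _ _).nullMeasurableSet _
  have hvol : volume (⋃ k ∈ F, T k) = ENNReal.ofReal (∑ k ∈ F, hexExcess k (q k) / 2) := by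
    rw [measure_biUnion_finset₀ hdisj.aedisjoint hTm,
      ENNReal.ofReal_sum_of_nonneg fun k hk => (half_pos (hpos k hk)).le]
    refine Finset.sum_congr rfl fun k hk => ?_
    rw [hT, volume_openTriangle_hexVertex, abs_of_pos (hpos k hk)]
  have hHT : Disjoint latticeHexagon (⋃ k ∈ F, T k) := by
    simp only [Set.disjoint_iUnion_right]
    refine fun k hk => Set.disjoint_left.2 fun p hp hpT => ?_
    obtain ⟨x, y, z, hx, hy, hz, hxyz, rfl⟩ := exists_weights_of_mem_openTriangle hpT
    have h := hexExcess_nonpos hp k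
    rw [hexExcess_combo k _ _ _ hxyz, hexExcess_hexVertex, hexExcess_hexVertex_add_one] at h
    have := mul_pos hz (hpos k hk)
    linarith
  have hTm' : NullMeasurableSet (⋃ k ∈ F, T k) volume :=
    .biUnion F.countable_toSet hTm
  rw [← hvol, ← measure_union₀ hTm' hHT.aedisjoint]
  refine measure_mono (Set.union_subset
    (convexHull_min (Set.range_subset_iff.2 hH) hQ) (Set.iUnion₂_subset fun k _ =>
      openTriangle_subset hQ (hH k) (hH (k + 1)) (hq k)))

/-- The triangles joining the edges of the hexagon to the farthest points beyond them do not
overlap. -/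
theorem pairwiseDisjoint_openTriangle {q : Fin 6 → ℝ × ℝ}
    (hmax : ∀ k j, hexExcess k (q j) ≤ hexExcess k (q k))
    (hlt : ∀ k, hexExcess k (q k) < 1) :
    {k | 0 < hexExcess k (q k)}.PairwiseDisjoint
      fun k => openTriangle (hexVertex k) (hexVertex (k + 1)) (q k) := by
  have hself : ∀ k, 0 < hexExcess k (q k) →
      ∀ p ∈ openTriangle (hexVertex k) (hexVertex (k + 1)) (q k), 0 < hexExcess k p := by
    intro k hk p hp
    obtain ⟨x, y, z, hx, hy, hz, hxyz, rfl⟩ := exists_weights_of_mem_openTriangle hp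
    rw [hexExcess_combo k _ _ _ hxyz, hexExcess_hexVertex, hexExcess_hexVertex_add_one]
    have := mul_pos hz hk
    linarith
  have hbound : ∀ k j,
      ∀ p ∈ openTriangle (hexVertex j) (hexVertex (j + 1)) (q j), hexExcess k p < 1 := by
    intro k j p hp
    obtain ⟨x, y, z, hx, hy, hz, hxyz, rfl⟩ := exists_weights_of_mem_openTriangle hp
    rw [hexExcess_combo k _ _ _ hxyz]
    have h1 := mul_nonneg hx.le (neg_nonneg.2 (hexExcess_hexVertex_nonpos k j))
    have h2 := mul_nonneg hy.le (neg_nonneg.2 (hexExcess_hexVertex_nonpos k (j + 1)))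
    have h3 := mul_pos hz (sub_pos.2 ((hmax k j).trans_lt (hlt k)))
    linarith
  have hadj : ∀ k, 0 < hexExcess k (q k) → 0 < hexExcess (k + 1) (q (k + 1)) →
      Disjoint (openTriangle (hexVertex k) (hexVertex (k + 1)) (q k))
        (openTriangle (hexVertex (k + 1)) (hexVertex (k + 1 + 1)) (q (k + 1))) := by
    intro k hk hk1
    refine Set.disjoint_left.2 fun p hp hp' => ?_
    have h1 : hexExcess k (q k) * hexExcess (k + 1) p <
        hexExcess (k + 1) (q (k + 1)) * hexExcess k p := by
      obtain ⟨x, y, z, hx, hy, hz, hxyz, rfl⟩ := exists_weights_of_mem_openTriangle hp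
      simp only [hexExcess_combo _ _ _ _ hxyz, hexExcess_hexVertex, hexExcess_hexVertex_add_one,
        hexExcess_add_one_hexVertex]
      nlinarith [mul_pos hx hk, mul_le_mul_of_nonneg_left (hmax (k + 1) k) (mul_pos hz hk).le]
    have h2 : hexExcess (k + 1) (q (k + 1)) * hexExcess k p <
        hexExcess k (q k) * hexExcess (k + 1) p := by
      obtain ⟨x, y, z, hx, hy, hz, hxyz, rfl⟩ := exists_weights_of_mem_openTriangle hp'
      simp only [hexExcess_combo _ _ _ _ hxyz, hexExcess_hexVertex, hexExcess_hexVertex_add_one,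
        hexExcess_hexVertex_add_two]
      nlinarith [mul_pos hy hk1, mul_le_mul_of_nonneg_left (hmax k (k + 1)) (mul_pos hz hk1).le]
    exact h1.not_gt h2
  have htwo : ∀ k, 0 < hexExcess k (q k) → 0 < hexExcess (k + 2) (q (k + 2)) →
      Disjoint (openTriangle (hexVertex k) (hexVertex (k + 1)) (q k))
        (openTriangle (hexVertex (k + 2)) (hexVertex (k + 2 + 1)) (q (k + 2))) := by
    intro k hk hk2
    refine Set.disjoint_left.2 fun p hp hp' => ?_
    have h := hexExcess_sub_one_add (k + 1) p
    rw [add_sub_cancel_right, show k + 1 + 1 = k + 2 from add_assoc k 1 1] at h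
    have h1 := hself _ hk _ hp
    have h2 := hself _ hk2 _ hp'
    have h3 := hbound (k + 1) k p hp
    linarith
  have hthree : ∀ k, 0 < hexExcess k (q k) → 0 < hexExcess (k + 3) (q (k + 3)) →
      Disjoint (openTriangle (hexVertex k) (hexVertex (k + 1)) (q k))
        (openTriangle (hexVertex (k + 3)) (hexVertex (k + 3 + 1)) (q (k + 3))) := by
    intro k hk hk3
    refine Set.disjoint_left.2 fun p hp hp' => ?_
    linarith [hexExcess_add_opposite k p, hself _ hk _ hp, hself _ hk3 _ hp']
  intro i hi j hj hij
  rcases fin_six_cases_of_ne hij with rfl | rfl | rfl | rfl | rfl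
  · exact hadj _ hi hj
  · exact (hadj _ hj hi).symm
  · exact htwo _ hi hj
  · exact (htwo _ hj hi).symm
  · exact hthree _ hi hj

theorem volume_latticeHexagon_add_half_le {S : Finset (ℝ × ℝ)} (hS : S.card ≤ 5)
    (hH : ∀ k, hexVertex k ∈ convexHull ℝ (S : Set (ℝ × ℝ))) :
    volume latticeHexagon + ENNReal.ofReal (1 / 2) ≤
      volume (convexHull ℝ (S : Set (ℝ × ℝ))) := by
  have hne : S.Nonempty := by
    have := convexHull_nonempty_iff.1 ⟨_, hH 0⟩
    exact_mod_cast this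
  choose q hqS hmax using fun k : Fin 6 => S.exists_max_image (hexExcess k) hne
  have hq : ∀ k, q k ∈ convexHull ℝ (S : Set (ℝ × ℝ)) := fun k =>
    subset_convexHull ℝ _ (hqS k)
  have hnonneg : ∀ k, 0 ≤ hexExcess k (q k) := fun k => by
    obtain ⟨s, hs, h⟩ :=
      (convexOn_hexExcess k).exists_ge_of_mem_convexHull (Set.subset_univ _) (hH k)
    rw [hexExcess_hexVertex] at h
    exact h.trans (hmax k s hs)
  have hsum : 1 ≤ ∑ k, hexExcess k (q k) := by
    by_contra! hlt
    obtain ⟨k, s, hs, h⟩ := exists_le_hexExcess hS hH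
      (d := fun k => hexExcess k (q k) + (1 - ∑ k, hexExcess k (q k)) / 6)
      (fun k => by linarith [hnonneg k])
      (by rw [Finset.sum_add_distrib]; simp; linarith)
    linarith [hmax k s hs]
  have key : ∃ F : Finset (Fin 6), (∀ k ∈ F, 0 < hexExcess k (q k)) ∧
      1 ≤ ∑ k ∈ F, hexExcess k (q k) ∧ (F : Set (Fin 6)).PairwiseDisjoint
        fun k => openTriangle (hexVertex k) (hexVertex (k + 1)) (q k) := by
    by_cases hlt : ∀ k, hexExcess k (q k) < 1
    · refine ⟨Finset.univ.filter fun k => 0 < hexExcess k (q k), by simp, ?_, ?_⟩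
      · rwa [Finset.sum_filter_of_ne fun k _ hk => (hnonneg k).lt_of_ne' hk]
      · simpa using pairwiseDisjoint_openTriangle (fun k j => hmax k _ (hqS j)) hlt
    · push Not at hlt
      obtain ⟨k, hk⟩ := hlt
      exact ⟨{k}, by simpa using zero_lt_one.trans_le hk, by simpa using hk, by simp⟩
  obtain ⟨F, hpos, hF, hdisj⟩ := key
  refine le_trans ?_ (volume_latticeHexagon_add_sum_le (convex_convexHull ℝ _) hH hq hpos hdisj)
  gcongr
  rw [← Finset.sum_div]
  linarith

theorem volume_latticeHexagon_le_volume_convexHull {S : Finset (ℝ × ℝ)} (hS : S.card ≤ 5)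
    (hH : latticeHexagon ⊆ convexHull ℝ (S : Set (ℝ × ℝ))) :
    ENNReal.ofReal (7 / 6) * volume latticeHexagon ≤
      volume (convexHull ℝ (S : Set (ℝ × ℝ))) := by
  refine le_trans ?_ (volume_latticeHexagon_add_half_le hS fun k =>
    hH (subset_convexHull ℝ _ ⟨k, rfl⟩))
  rw [show (7 / 6 : ℝ) = 1 + 1 / 6 by norm_num,
    ENNReal.ofReal_add zero_le_one (by norm_num), ENNReal.ofReal_one, add_mul, one_mul]
  gcongr
  refine (mul_le_mul_right volume_latticeHexagon_le _).trans_eq ?_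
  rw [show (3 : ENNReal) = ENNReal.ofReal 3 by simp, ← ENNReal.ofReal_mul (by norm_num)]
  norm_num

/-- A linear map sends the vertices of `latticeHexagon` to those of the regular hexagon. -/
theorem planeMap_hexVertex (k : Fin 6) :
    planeMap (1, 0) (-(1 / 2), √3 / 2) (hexVertex k) =
      (cos (π * k / 3), sin (π * k / 3)) := by
  have h2 : π * 2 / 3 = π - π / 3 := by ring
  have h4 : π * 4 / 3 = π / 3 + π := by ring
  have h5 : π * 5 / 3 = 2 * π - π / 3 := by ring
  fin_cases k <;> simp [planeMap_apply, hexVertex, h2, h4, h5] <;> norm_num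

/-- Every convex pentagon containing the regular hexagon has area at least
`7/6` times the area of the hexagon. -/
theorem regular_hexagon_pentagon_lower_bound
    (P : Set (ℝ × ℝ))
    (hP : P = convexHull ℝ
      {p : ℝ × ℝ | ∃ k : Fin 6, p = (cos (π * k / 3), sin (π * k / 3))})
    (Q : Set (ℝ × ℝ)) (hQ : IsConvexPolygon 5 Q) (hPQ : P ⊆ Q) :
    ENNReal.ofReal (7 / 6) * volume P ≤ volume Q := by
  obtain ⟨S, hS, rfl, -⟩ := hQ
  set L := planeMap (1, 0) (-(1 / 2), √3 / 2) with hL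
  have hdet : LinearMap.det L ≠ 0 := by
    rw [hL, det_planeMap]
    simp
  let e := LinearMap.equivOfDetNeZero L hdet
  have he : ∀ p, L (e.symm p) = p := e.apply_symm_apply
  have hPL : P = L '' latticeHexagon := by
    rw [hP, latticeHexagon, LinearMap.image_convexHull, ← Set.range_comp]
    congr 1
    ext p
    simp only [Set.mem_range, Function.comp_apply, hL, planeMap_hexVertex, eq_comm]
    rfl
  have hSL : convexHull ℝ (S : Set (ℝ × ℝ)) =
      L '' convexHull ℝ ((S.image e.symm : Finset (ℝ × ℝ)) : Set (ℝ × ℝ)) := by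
    rw [LinearMap.image_convexHull, Finset.coe_image, Set.image_image]
    simp [he]
  have hinj : Function.Injective L := e.injective
  rw [hSL, hPL, Set.image_subset_image_iff hinj] at hPQ
  rw [hSL, hPL, Measure.addHaar_image_linearMap, Measure.addHaar_image_linearMap, mul_left_comm]
  gcongr
  exact volume_latticeHexagon_le_volume_convexHull (Finset.card_image_le.trans hS) hPQ
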